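/- Let d ≥ 2 be an even integer. Then there exist constants C > 0 and ε₀ > 0 such that for all 0 < ε < ε₀, |∫_0^ε u^{-1/2} exp(u) E_{(d+1)/2}(u) du − (4/(d-1)) √ε| ≤ C ε^{min(d,3)/2}. -/

import Mathlib

open MeasureTheory Real

/-- The generalized exponential integral `E_ν(x) = ∫_1^∞ exp(-x t) t^{-ν} dt`. -/
noncomputable def genExpInt (ν x : ℝ) : ℝ :=
  ∫ t in Set.Ioi (1:ℝ), Real.exp (-x * t) / t ^ ν


lemma aux_kint (ν u : ℝ) (hν : 1 < ν) (hu : 0 < u) :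
    IntegrableOn (fun t : ℝ => Real.exp (-u * (t - 1)) * t ^ (-ν)) (Set.Ioi 1) := by
  have h0 : IntegrableOn (fun t : ℝ => t ^ (-ν)) (Set.Ioi 1) :=
    integrableOn_Ioi_rpow_of_lt (by linarith) one_pos
  refine Integrable.mono' h0 (by fun_prop) ?_
  refine (ae_restrict_iff' measurableSet_Ioi).2 (Filter.Eventually.of_forall fun t ht => ?_)
  have ht : (1:ℝ) < t := ht
  have hp : 0 < t ^ (-ν) := Real.rpow_pos_of_pos (by linarith) _
  rw [Real.norm_of_nonneg (by positivity)]
  have : Real.exp (-u * (t - 1)) ≤ 1 := by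
    rw [Real.exp_le_one_iff]; nlinarith
  nlinarith

lemma aux_kint' (ν u : ℝ) (hν : 1 < ν) (hu : 0 < u) :
    IntegrableOn (fun t : ℝ => (1 - Real.exp (-u * (t - 1))) * t ^ (-ν)) (Set.Ioi 1) := by
  have h0 : IntegrableOn (fun t : ℝ => t ^ (-ν)) (Set.Ioi 1) :=
    integrableOn_Ioi_rpow_of_lt (by linarith) one_pos
  have := h0.sub (aux_kint ν u hν hu)
  refine this.congr (Filter.Eventually.of_forall fun t => ?_)
  simp only [Pi.sub_apply]; ring

lemma aux_eq (ν u : ℝ) (hν : 1 < ν) (hu : 0 < u) :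
    Real.exp u * genExpInt ν u - 1 / (ν - 1) =
      - ∫ t in Set.Ioi (1:ℝ), (1 - Real.exp (-u * (t - 1))) * t ^ (-ν) := by
  have h0 : IntegrableOn (fun t : ℝ => t ^ (-ν)) (Set.Ioi 1) :=
    integrableOn_Ioi_rpow_of_lt (by linarith) one_pos
  have h1 : ∫ t in Set.Ioi (1:ℝ), t ^ (-ν) = 1 / (ν - 1) := by
    rw [integral_Ioi_rpow_of_lt (by linarith) one_pos, Real.one_rpow,
      show -ν + 1 = -(ν - 1) by ring, neg_div_neg_eq]
  have h2 : Real.exp u * genExpInt ν u =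
      ∫ t in Set.Ioi (1:ℝ), Real.exp (-u * (t - 1)) * t ^ (-ν) := by
    unfold genExpInt
    rw [← integral_const_mul]
    refine setIntegral_congr_fun measurableSet_Ioi fun t ht => ?_
    have ht : (1:ℝ) < t := ht
    rw [Real.rpow_neg (by linarith), show -u * (t - 1) = u + -u * t by ring, Real.exp_add]
    ring
  rw [h2, ← h1, ← integral_sub (aux_kint ν u hν hu) h0, ← integral_neg]
  congr 1; ext t; ring

lemma aux_abs (ν u : ℝ) (hν : 1 < ν) (hu : 0 < u) :
    |Real.exp u * genExpInt ν u - 1 / (ν - 1)| =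
      ∫ t in Set.Ioi (1:ℝ), (1 - Real.exp (-u * (t - 1))) * t ^ (-ν) := by
  rw [aux_eq ν u hν hu, abs_neg, abs_of_nonneg]
  refine setIntegral_nonneg measurableSet_Ioi fun t ht => ?_
  have ht : (1:ℝ) < t := ht
  have : Real.exp (-u * (t - 1)) ≤ 1 := by
    rw [Real.exp_le_one_iff]; nlinarith
  exact mul_nonneg (by linarith) (Real.rpow_nonneg (by linarith) _)

lemma aux_le (ν u t : ℝ) (hu : 0 < u) (ht : 1 < t) :
    (1 - Real.exp (-u * (t - 1))) * t ^ (-ν) ≤ u * t ^ (1 - ν) := by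
  have h := Real.add_one_le_exp (-u * (t - 1))
  rw [show 1 - ν = 1 + -ν by ring, Real.rpow_add (by linarith), Real.rpow_one, ← mul_assoc]
  refine mul_le_mul_of_nonneg_right ?_ (Real.rpow_nonneg (by linarith) _)
  nlinarith

lemma aux_big (ν u : ℝ) (hν : 5 / 2 ≤ ν) (hu : 0 < u) :
    |Real.exp u * genExpInt ν u - 1 / (ν - 1)| ≤ 4 * u := by
  rw [aux_abs ν u (by linarith) hu]
  have hi : IntegrableOn (fun t : ℝ => u * t ^ (1 - ν)) (Set.Ioi 1) :=
    (integrableOn_Ioi_rpow_of_lt (by linarith) one_pos).const_mul u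
  refine (setIntegral_mono_on (aux_kint' ν u (by linarith) hu) hi measurableSet_Ioi
    fun t ht => aux_le ν u t hu ht).trans ?_
  rw [integral_const_mul, integral_Ioi_rpow_of_lt (by linarith) one_pos, Real.one_rpow,
    show 1 - ν + 1 = -(ν - 2) by ring, neg_div_neg_eq]
  have : 1 / (ν - 2) ≤ 4 := by
    rw [div_le_iff₀ (by linarith)]; linarith
  nlinarith

lemma aux_two (u : ℝ) (hu : 0 < u) (hu1 : u < 1) :
    |Real.exp u * genExpInt (3/2) u - 1 / (3/2 - 1)| ≤ 4 * u ^ ((1:ℝ)/2) := by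
  rw [aux_abs _ u (by norm_num) hu]
  have hT : 1 < u⁻¹ := (one_lt_inv₀ hu).2 hu1
  have hk := aux_kint' (3/2) u (by norm_num) hu
  rw [← Set.Ioc_union_Ioi_eq_Ioi hT.le] at hk ⊢
  have hk1 := hk.mono_set Set.subset_union_left
  have hk2 := hk.mono_set Set.subset_union_right
  rw [setIntegral_union (Set.Ioc_disjoint_Ioi le_rfl) measurableSet_Ioi hk1 hk2]
  have hTp : u⁻¹ ^ ((1:ℝ)/2) = (u ^ ((1:ℝ)/2))⁻¹ := Real.inv_rpow hu.le _
  have hup : 0 < u ^ ((1:ℝ)/2) := Real.rpow_pos_of_pos hu _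
  have hsq : u = u ^ ((1:ℝ)/2) * u ^ ((1:ℝ)/2) := by
    rw [← Real.rpow_add hu]; norm_num
  have b1 : ∫ t in Set.Ioc 1 u⁻¹, (1 - Real.exp (-u * (t - 1))) * t ^ (-(3/2:ℝ))
      ≤ 2 * u ^ ((1:ℝ)/2) := by
    have hii : IntervalIntegrable (fun t : ℝ => u * t ^ (1 - (3/2:ℝ))) volume 1 u⁻¹ :=
      (intervalIntegral.intervalIntegrable_rpow' (by norm_num)).const_mul u
    have hi := (intervalIntegrable_iff_integrableOn_Ioc_of_le hT.le).1 hii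
    refine (setIntegral_mono_on hk1 hi measurableSet_Ioc
      fun t ht => aux_le _ u t hu ht.1).trans ?_
    rw [← intervalIntegral.integral_of_le hT.le, intervalIntegral.integral_const_mul,
      integral_rpow (Or.inl (by norm_num)), Real.one_rpow,
      show (1 - 3/2 + 1 : ℝ) = 1/2 by norm_num, hTp]
    have : u * (u ^ ((1:ℝ)/2))⁻¹ = u ^ ((1:ℝ)/2) := by
      nth_rewrite 1 [hsq]
      field_simp
    have e : u * (((u ^ ((1:ℝ)/2))⁻¹ - 1) / (1/2)) =
      2 * (u * (u ^ ((1:ℝ)/2))⁻¹) - 2 * u := by ring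
    rw [e, this]; linarith
  have b2 : ∫ t in Set.Ioi u⁻¹, (1 - Real.exp (-u * (t - 1))) * t ^ (-(3/2:ℝ))
      ≤ 2 * u ^ ((1:ℝ)/2) := by
    have hi : IntegrableOn (fun t : ℝ => t ^ (-(3/2:ℝ))) (Set.Ioi u⁻¹) :=
      integrableOn_Ioi_rpow_of_lt (by norm_num) (by linarith)
    refine (setIntegral_mono_on hk2 hi measurableSet_Ioi fun t ht => ?_).trans ?_
    · have ht : u⁻¹ < t := ht
      have : 0 ≤ t ^ (-(3/2:ℝ)) := Real.rpow_nonneg (by linarith) _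
      nlinarith [Real.exp_pos (-u * (t - 1))]
    · rw [integral_Ioi_rpow_of_lt (by norm_num) (by linarith),
        show (-(3/2) + 1 : ℝ) = -(1/2) by norm_num, Real.rpow_neg (by positivity), hTp, inv_inv]
      linarith
  linarith

lemma aux_meas (ν : ℝ) : StronglyMeasurable (genExpInt ν) := by
  unfold genExpInt
  apply StronglyMeasurable.integral_prod_right (f := fun (x t : ℝ) => Real.exp (-x * t) / t ^ ν)
  apply Measurable.stronglyMeasurable
  simp only [Function.uncurry_def]
  fun_prop

lemma aux_main (ν m : ℝ) (hm : 0 < m)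
    (h : ∀ u : ℝ, 0 < u → u < 1 →
      |Real.exp u * genExpInt ν u - 1 / (ν - 1)| ≤ 4 * u ^ ((m - 1) / 2))
    (ε : ℝ) (h0 : 0 < ε) (h1 : ε < 1) :
    |(∫ u in (0:ℝ)..ε, u ^ (-(1:ℝ)/2) * Real.exp u * genExpInt ν u)
      - 2 / (ν - 1) * Real.sqrt ε| ≤ 8 / m * ε ^ (m / 2) := by
  have hc : IntervalIntegrable (fun u : ℝ => 1 / (ν - 1) * u ^ (-(1:ℝ)/2)) volume 0 ε :=
    (intervalIntegral.intervalIntegrable_rpow' (by norm_num)).const_mul _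
  have hci : ∫ u in (0:ℝ)..ε, 1 / (ν - 1) * u ^ (-(1:ℝ)/2) = 2 / (ν - 1) * Real.sqrt ε := by
    rw [intervalIntegral.integral_const_mul, integral_rpow (Or.inl (by norm_num)),
      show (-1/2 + 1 : ℝ) = 1/2 by norm_num, Real.zero_rpow (by norm_num), Real.sqrt_eq_rpow]
    ring
  have hb : IntervalIntegrable (fun u : ℝ => 4 * u ^ (m/2 - 1)) volume 0 ε :=
    (intervalIntegral.intervalIntegrable_rpow' (by linarith)).const_mul _
  have hbi : ∫ u in (0:ℝ)..ε, 4 * u ^ (m/2 - 1) = 8 / m * ε ^ (m / 2) := by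
    rw [intervalIntegral.integral_const_mul, integral_rpow (Or.inl (by linarith)),
      show (m/2 - 1 + 1 : ℝ) = m/2 by ring, Real.zero_rpow (by positivity)]
    field_simp; ring
  have hpt : ∀ u ∈ Set.Ioc 0 ε, ‖u ^ (-(1:ℝ)/2) * Real.exp u * genExpInt ν u
      - 1 / (ν - 1) * u ^ (-(1:ℝ)/2)‖ ≤ 4 * u ^ (m/2 - 1) := by
    intro u hu
    have hp : 0 < u ^ (-(1:ℝ)/2) := Real.rpow_pos_of_pos hu.1 _
    rw [show u ^ (-(1:ℝ)/2) * Real.exp u * genExpInt ν u - 1 / (ν - 1) * u ^ (-(1:ℝ)/2)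
      = u ^ (-(1:ℝ)/2) * (Real.exp u * genExpInt ν u - 1 / (ν - 1)) by ring,
      norm_mul, Real.norm_of_nonneg hp.le, Real.norm_eq_abs,
      show m/2 - 1 = -1/2 + (m-1)/2 by ring, Real.rpow_add hu.1]
    have := mul_le_mul_of_nonneg_left (h u hu.1 (by linarith [hu.2])) hp.le
    linarith
  have hmeas := (aux_meas ν).measurable
  have hd : IntervalIntegrable (fun u : ℝ => u ^ (-(1:ℝ)/2) * Real.exp u * genExpInt ν u
      - 1 / (ν - 1) * u ^ (-(1:ℝ)/2)) volume 0 ε := by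
    rw [intervalIntegrable_iff_integrableOn_Ioc_of_le h0.le] at hb ⊢
    refine Integrable.mono' hb (Measurable.aestronglyMeasurable (by fun_prop)) ?_
    exact (ae_restrict_iff' measurableSet_Ioc).2 (Filter.Eventually.of_forall hpt)
  have hF : IntervalIntegrable (fun u : ℝ => u ^ (-(1:ℝ)/2) * Real.exp u * genExpInt ν u)
      volume 0 ε := by
    have := hd.add hc
    refine this.congr (fun u _ => ?_)
    simp
  rw [← hci, ← intervalIntegral.integral_sub hF hc, ← hbi, ← Real.norm_eq_abs]
  exact intervalIntegral.norm_integral_le_of_norm_le h0.le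
    (Filter.Eventually.of_forall hpt) hb

theorem small_eps_asymptotics_d_even (d : ℕ) (hd : 2 ≤ d) (heven : Even d) :
    ∃ C > (0:ℝ), ∃ ε₀ > (0:ℝ), ∀ ε : ℝ, 0 < ε → ε < ε₀ →
      |(∫ u in (0:ℝ)..ε, u ^ (-(1:ℝ)/2) * Real.exp u * genExpInt (((d:ℝ) + 1) / 2) u)
          - (4 / ((d:ℝ) - 1)) * Real.sqrt ε|
        ≤ C * ε ^ ((min d 3 : ℝ) / 2) := by
  have hd' : (2:ℝ) ≤ d := by exact_mod_cast hd
  have hm : (0:ℝ) < min (d:ℝ) 3 := lt_min (by linarith) (by norm_num)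
  refine ⟨8 / min (d:ℝ) 3, by positivity, 1, one_pos, fun ε h0 h1 => ?_⟩
  have hc : 4 / ((d:ℝ) - 1) = 2 / (((d:ℝ) + 1) / 2 - 1) := by
    have : (d:ℝ) - 1 ≠ 0 := by linarith
    rw [show ((d:ℝ) + 1) / 2 - 1 = (d - 1) / 2 by ring]
    field_simp; norm_num
  rw [hc]
  refine aux_main _ _ hm (fun u hu hu1 => ?_) ε h0 h1
  rcases Nat.lt_or_ge d 4 with h4 | h4
  · have : d = 2 := by
      obtain ⟨k, hk⟩ := heven
      omega
    subst this
    have := aux_two u hu hu1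
    norm_num at this ⊢
    exact this
  · have h4' : (4:ℝ) ≤ d := by exact_mod_cast h4
    rw [min_eq_right (by linarith), show ((3:ℝ) - 1) / 2 = 1 by norm_num, Real.rpow_one]
    exact aux_big _ u (by linarith) hu
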